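/- For any parity decision tree T on n variables, E_{ℓ∈T}[(∑_{i=1}^n ℓ_i)²] ≤ 2·D̄(T), where D̄(T) is the average depth of T, i.e., the expected number of internal nodes on the root-to-leaf path followed by a uniform random input x ∈ {-1,1}^n, and ℓ ranges over the leaves of T with the distribution induced by a uniform random input. -/

import Mathlib

open Finset

/-- The ±1 sign value of a boolean: `true ↦ 1`, `false ↦ -1`. -/
def bsign (b : Bool) : ℝ := if b then 1 else -1

/-- The parity character `χ_S(x) = ∏_{i ∈ S} x_i` (with `x_i = ±1`), as an integer. -/
def chi {n : ℕ} (S : Finset (Fin n)) (x : Fin n → Bool) : ℤ :=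
  ∏ i ∈ S, (if x i then 1 else -1)

/-- Parity decision trees on `n` variables, with leaves labelled in `{-1,1}`
(encoded as `Bool`, `true ↦ 1`, `false ↦ -1`).  At an internal node labelled `S`,
an input `x` follows the edge labelled `χ_S(x)`: the `tpos` child if `χ_S(x) = 1`
and the `tneg` child if `χ_S(x) = -1`. -/
inductive PDT (n : ℕ) : Type where
  | leaf (b : Bool) : PDT n
  | node (S : Finset (Fin n)) (tneg tpos : PDT n) : PDT n

namespace PDT

variable {n : ℕ}

/-- The depth of the tree: maximum number of internal nodes on a root-to-leaf path. -/
def depth : PDT n → ℕ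
  | leaf _ => 0
  | node _ t0 t1 => max (depth t0) (depth t1) + 1

/-- The label of the leaf reached by input `x`. -/
def eval : PDT n → (Fin n → Bool) → Bool
  | leaf b, _ => b
  | node S t0 t1, x => if chi S x = 1 then eval t1 x else eval t0 x

/-- The identity of the leaf reached by input `x`, recorded as the sequence of
branches taken along the root-to-leaf path. -/
def leafId : PDT n → (Fin n → Bool) → List Bool
  | leaf _, _ => []
  | node S t0 t1, x =>
      if chi S x = 1 then true :: leafId t1 x else false :: leafId t0 x

/-- Number of internal nodes on the root-to-leaf path followed by input `x`. -/
def depthOn : PDT n → (Fin n → Bool) → ℕ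
  | leaf _, _ => 0
  | node S t0 t1, x =>
      (if chi S x = 1 then depthOn t1 x else depthOn t0 x) + 1

/-- `T` computes `f` if every input reaches a leaf labelled `f x`. -/
def Computes (T : PDT n) (f : (Fin n → Bool) → Bool) : Prop :=
  ∀ x, T.eval x = f x

/-- The vector `ℓ ∈ {-1,0,1}^n` associated to the leaf reached by `x`:
`ℓ i` is the average of the `i`-th coordinate (as a `±1` value) over the
uniform distribution on inputs reaching that leaf. -/
noncomputable def leafVec (T : PDT n) (x : Fin n → Bool) (i : Fin n) : ℝ :=
  (∑ y : Fin n → Bool, if T.leafId y = T.leafId x then bsign (y i) else 0) /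
    ((Finset.univ.filter fun y : Fin n → Bool => T.leafId y = T.leafId x).card)

/-- A boolean-valued function `φ` of the input is fixed by the path to the leaf
reached by `x` if it is constant on the set of inputs reaching that leaf. -/
def FixedAt (T : PDT n) (x : Fin n → Bool) (φ : (Fin n → Bool) → Bool) : Prop :=
  ∀ y z : Fin n → Bool, T.leafId y = T.leafId x → T.leafId z = T.leafId x → φ y = φ z

/-- `T` is (pairwise) correlation-free: along any root-to-leaf path, whenever
`x_i ⊕ x_j` (for `i ≠ j`) is fixed, both `x_i` and `x_j` are fixed. -/
def CorrelationFree (T : PDT n) : Prop :=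
  ∀ i j : Fin n, i ≠ j → ∀ x : Fin n → Bool,
    FixedAt T x (fun y => xor (y i) (y j)) →
    FixedAt T x (fun y => y i) ∧ FixedAt T x (fun y => y j)

/-- `T'` refines `T`: the set of inputs reaching any given leaf of `T'` is
contained in the set of inputs reaching some leaf of `T`. -/
def Refines (T' T : PDT n) : Prop :=
  ∀ y z : Fin n → Bool, T'.leafId y = T'.leafId z → T.leafId y = T.leafId z

/-- An ordinary decision tree: every internal node queries a single coordinate. -/
def Ordinary : PDT n → Prop
  | leaf _ => True
  | node S t0 t1 => (∃ i : Fin n, S = {i}) ∧ Ordinary t0 ∧ Ordinary t1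

end PDT

/-- The linear Fourier coefficient `f̂(i) = E_x[f(x)·x_i]` over uniform `x ∈ {-1,1}^n`. -/
noncomputable def fhat {n : ℕ} (f : (Fin n → Bool) → Bool) (i : Fin n) : ℝ :=
  (∑ x : Fin n → Bool, bsign (f x) * bsign (x i)) / 2 ^ n

/-- The index of coordinate `j` of the `i`-th block of `n` consecutive coordinates. -/
def blockIdx {m n : ℕ} (i : Fin m) (j : Fin n) : Fin (m * n) :=
  ⟨i.1 * n + j.1, by
    have hj := j.isLt
    calc i.1 * n + j.1 < i.1 * n + n := by omega
      _ = (i.1 + 1) * n := by ring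
      _ ≤ m * n := Nat.mul_le_mul_right n i.isLt⟩

/-- Composition `f ∘ g` on `m·n` variables, applying `g` to each of the `m` blocks
of `n` consecutive coordinates. -/
def compose {m n : ℕ} (f : (Fin m → Bool) → Bool) (g : (Fin n → Bool) → Bool)
    (x : Fin (m * n) → Bool) : Bool :=
  f fun i => g fun j => x (blockIdx i j)

/-- `MAJ₃`: returns `1` (`true`) iff `x₁ + x₂ + x₃ > 0` for `x ∈ {-1,1}³`. -/
def maj3 (x : Fin 3 → Bool) : Bool :=
  decide (0 < (if x 0 then 1 else -1) + (if x 1 then 1 else -1) + (if x 2 then (1 : ℤ) else -1))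

/-- The recursive majority function `MAJ₃^{⊗k}`, with `MAJ₃^{⊗1} = MAJ₃` and
`MAJ₃^{⊗k}` applying `MAJ₃` to `MAJ₃^{⊗(k-1)}` evaluated on the three blocks of
`3^{k-1}` consecutive coordinates. -/
def recMaj : (k : ℕ) → (Fin (3 ^ k) → Bool) → Bool
  | 0, x => x ⟨0, by norm_num⟩
  | k + 1, x => maj3 fun b =>
      recMaj k fun j => x ⟨b.1 * 3 ^ k + j.1, by
        have hb := b.isLt
        have hj := j.isLt
        calc b.1 * 3 ^ k + j.1 < b.1 * 3 ^ k + 3 ^ k := by omega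
          _ = (b.1 + 1) * 3 ^ k := by ring
          _ ≤ 3 * 3 ^ k := Nat.mul_le_mul_right (3 ^ k) hb
          _ = 3 ^ (k + 1) := by ring⟩

theorem bsign_mul_self (b : Bool) : bsign b * bsign b = 1 := by
  cases b <;> simp [bsign]

/-- The coordinatewise sum of three inputs over the field with two elements. -/
def xor3 {n : ℕ} (y z w : Fin n → Bool) (i : Fin n) : Bool := xor (y i) (xor (z i) (w i))

theorem xor3_xor3_cancel {n : ℕ} (u y z : Fin n → Bool) : xor3 (xor3 u y z) y z = u := by
  funext i
  simp only [xor3]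
  cases u i <;> cases y i <;> cases z i <;> rfl

theorem bsign_xor3 {n : ℕ} (y z w : Fin n → Bool) (i : Fin n) :
    bsign (xor3 y z w i) = bsign (y i) * bsign (z i) * bsign (w i) := by
  simp only [xor3]
  cases y i <;> cases z i <;> cases w i <;> simp [bsign]

theorem chi_xor3 {n : ℕ} (S : Finset (Fin n)) (y z w : Fin n → Bool) :
    chi S (xor3 y z w) = chi S y * chi S z * chi S w := by
  simp only [chi, ← Finset.prod_mul_distrib]
  refine Finset.prod_congr rfl fun i _ => ?_
  rcases Bool.eq_false_or_eq_true (y i) with hy | hy <;>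
  rcases Bool.eq_false_or_eq_true (z i) with hz | hz <;>
  rcases Bool.eq_false_or_eq_true (w i) with hw | hw <;> simp [xor3, hy, hz, hw]

theorem chi_eq_one_or_neg_one {n : ℕ} (S : Finset (Fin n)) (y : Fin n → Bool) :
    chi S y = 1 ∨ chi S y = -1 := by
  refine Finset.prod_induction _ (fun a : ℤ => a = 1 ∨ a = -1) ?_ (Or.inl rfl) ?_
  · rintro a b (rfl | rfl) (rfl | rfl) <;> simp
  · intro i _
    cases y i <;> simp

/-- A set of inputs is closed under sums of triples, i.e. it is an affine subspace over the
field with two elements (or empty). -/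
def IsAffine {n : ℕ} (A : Finset (Fin n → Bool)) : Prop :=
  ∀ y ∈ A, ∀ z ∈ A, ∀ w ∈ A, xor3 y z w ∈ A

theorem IsAffine.sum_eq_zero {n : ℕ} {A : Finset (Fin n → Bool)} (hA : IsAffine A)
    {φ : (Fin n → Bool) → ℝ} (hφ : ∀ y z w, φ (xor3 y z w) = φ y * φ z * φ w)
    {y z : Fin n → Bool} (hy : y ∈ A) (hz : z ∈ A) (hyz : φ y * φ z = -1) :
    ∑ u ∈ A, φ u = 0 := by
  have h : ∑ u ∈ A, φ u = ∑ u ∈ A, -φ u := by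
    refine Finset.sum_nbij' (fun u => xor3 u y z) (fun u => xor3 u y z)
      (fun u hu => hA u hu y hy z hz) (fun u hu => hA u hu y hy z hz)
      (fun u _ => xor3_xor3_cancel u y z) (fun u _ => xor3_xor3_cancel u y z) fun u _ => ?_
    rw [hφ, mul_assoc, hyz]
    ring
  rw [Finset.sum_neg_distrib] at h
  linarith

theorem IsAffine.filter_chi {n : ℕ} {A : Finset (Fin n → Bool)} (hA : IsAffine A)
    (S : Finset (Fin n)) (x : Fin n → Bool) :
    IsAffine (A.filter fun y => chi S y = chi S x) := by
  intro y hy z hz w hw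
  simp only [Finset.mem_filter] at *
  refine ⟨hA y hy.1 z hz.1 w hw.1, ?_⟩
  rw [chi_xor3, hy.2, hz.2, hw.2]
  rcases chi_eq_one_or_neg_one S x with h | h <;> simp [h]

theorem IsAffine.card_le_two_mul_card_filter_chi {n : ℕ} {A : Finset (Fin n → Bool)}
    (hA : IsAffine A) (S : Finset (Fin n)) {x : Fin n → Bool} (hx : x ∈ A) :
    A.card ≤ 2 * (A.filter fun y => chi S y = chi S x).card := by
  have hsplit := Finset.card_filter_add_card_filter_not (s := A) (fun y => chi S y = chi S x)
  suffices h : (A.filter fun y => ¬ chi S y = chi S x).card ≤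
      (A.filter fun y => chi S y = chi S x).card by omega
  rcases (A.filter fun y => ¬ chi S y = chi S x).eq_empty_or_nonempty with h | ⟨z, hz⟩
  · simp [h]
  · refine Finset.card_le_card_of_injOn (fun u => xor3 u z x) ?_ ?_
    · intro u hu
      simp only [Finset.coe_filter, Set.mem_ofPred_eq, Finset.mem_filter] at *
      refine ⟨hA u hu.1 z hz.1 x hx, ?_⟩
      rw [chi_xor3]
      rcases chi_eq_one_or_neg_one S x with h | h <;>
      rcases chi_eq_one_or_neg_one S u with h' | h' <;>
      rcases chi_eq_one_or_neg_one S z with h'' | h'' <;> simp_all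
    · intro u _ v _ huv
      have := congrArg (fun t => xor3 t z x) huv
      simpa only [xor3_xor3_cancel] using this

theorem PDT.leafId_node_eq_iff {n : ℕ} (S : Finset (Fin n)) (t0 t1 : PDT n)
    (y x : Fin n → Bool) :
    (PDT.node S t0 t1).leafId y = (PDT.node S t0 t1).leafId x ↔ chi S y = chi S x ∧
      (if chi S x = 1 then t1 else t0).leafId y = (if chi S x = 1 then t1 else t0).leafId x := by
  rcases chi_eq_one_or_neg_one S x with h | h <;>
  rcases chi_eq_one_or_neg_one S y with h' | h' <;> simp [PDT.leafId, h, h']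

theorem PDT.depthOn_node {n : ℕ} (S : Finset (Fin n)) (t0 t1 : PDT n) (x : Fin n → Bool) :
    (PDT.node S t0 t1).depthOn x = (if chi S x = 1 then t1 else t0).depthOn x + 1 := by
  simp only [PDT.depthOn]
  split_ifs <;> rfl

theorem IsAffine.filter_leafId {n : ℕ} (T : PDT n) (x : Fin n → Bool)
    {A : Finset (Fin n → Bool)} (hA : IsAffine A) (hx : x ∈ A) :
    IsAffine (A.filter fun y => T.leafId y = T.leafId x) ∧
      A.card ≤ 2 ^ T.depthOn x * (A.filter fun y => T.leafId y = T.leafId x).card := by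
  induction T generalizing A with
  | leaf b => simpa [PDT.leafId, PDT.depthOn] using hA
  | node S t0 t1 ih0 ih1 =>
    have key := hA.card_le_two_mul_card_filter_chi S hx
    have hB := hA.filter_chi S x
    have hxB : x ∈ A.filter fun y => chi S y = chi S x := by simp [hx]
    simp only [PDT.leafId_node_eq_iff, PDT.depthOn_node, ← Finset.filter_filter]
    rw [pow_succ, mul_comm _ 2, mul_assoc]
    split_ifs
    · exact ⟨(ih1 hB hxB).1, key.trans (Nat.mul_le_mul_left 2 (ih1 hB hxB).2)⟩
    · exact ⟨(ih0 hB hxB).1, key.trans (Nat.mul_le_mul_left 2 (ih0 hB hxB).2)⟩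

/-- Over `A`, coordinate `i` is balanced and uncorrelated with every other coordinate. -/
def IsLonely {n : ℕ} (A : Finset (Fin n → Bool)) (i : Fin n) : Prop :=
  ∑ y ∈ A, bsign (y i) = 0 ∧ ∀ j, j ≠ i → ∑ y ∈ A, bsign (y i) * bsign (y j) = 0

theorem sum_sq_of_isLonely {n : ℕ} {A : Finset (Fin n → Bool)} {F : Finset (Fin n)}
    (hF : ∀ i ∈ F, IsLonely A i) :
    ∑ y ∈ A, (∑ i ∈ F, bsign (y i)) ^ 2 = A.card * F.card := by
  simp only [sq, Finset.sum_mul_sum]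
  rw [Finset.sum_comm]
  have h : ∀ i ∈ F, ∑ y ∈ A, ∑ j ∈ F, bsign (y i) * bsign (y j) = A.card := by
    intro i hi
    rw [Finset.sum_comm, Finset.sum_eq_single_of_mem i hi fun j _ hj => (hF i hi).2 j hj]
    simp [bsign_mul_self]
  rw [Finset.sum_congr rfl h]
  simp [mul_comm]

/-- The variance of the sum of the coordinates is at least the number of lonely coordinates. -/
theorem sq_sum_add_card_le_of_isLonely {n : ℕ} {A : Finset (Fin n → Bool)} {F : Finset (Fin n)}
    (hF : ∀ i ∈ F, IsLonely A i) :
    (∑ y ∈ A, ∑ i, bsign (y i)) ^ 2 + (A.card : ℝ) ^ 2 * F.card ≤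
      A.card * ∑ y ∈ A, (∑ i, bsign (y i)) ^ 2 := by
  have hsplit : ∀ y : Fin n → Bool,
      ∑ i, bsign (y i) = ∑ i ∈ F, bsign (y i) + ∑ i ∈ Fᶜ, bsign (y i) :=
    fun y => (Finset.sum_add_sum_compl F _).symm
  have hmean : ∑ y ∈ A, ∑ i ∈ F, bsign (y i) = 0 := by
    rw [Finset.sum_comm]
    exact Finset.sum_eq_zero fun i hi => (hF i hi).1
  have hcross : ∑ y ∈ A, (∑ i ∈ F, bsign (y i)) * ∑ i ∈ Fᶜ, bsign (y i) = 0 := by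
    simp only [Finset.sum_mul_sum]
    rw [Finset.sum_comm]
    refine Finset.sum_eq_zero fun i hi => ?_
    rw [Finset.sum_comm]
    refine Finset.sum_eq_zero fun j hj => (hF i hi).2 j ?_
    rintro rfl
    exact Finset.mem_compl.1 hj hi
  have hcs := sq_sum_le_card_mul_sum_sq (s := A)
    (f := fun y : Fin n → Bool => ∑ i ∈ Fᶜ, bsign (y i))
  have hdiag := sum_sq_of_isLonely hF
  have hexp : ∑ y ∈ A, (∑ i, bsign (y i)) ^ 2 =
      A.card * F.card + ∑ y ∈ A, (∑ i ∈ Fᶜ, bsign (y i)) ^ 2 := by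
    simp only [hsplit, add_sq, Finset.sum_add_distrib, mul_assoc, ← Finset.mul_sum, hcross, hdiag]
    ring
  rw [hexp]
  simp only [hsplit, Finset.sum_add_distrib, hmean, zero_add]
  nlinarith

theorem IsAffine.isLonely {n : ℕ} {A : Finset (Fin n → Bool)} (hA : IsAffine A)
    {x : Fin n → Bool} (hx : x ∈ A) {i : Fin n} (hi : ∃ y ∈ A, y i ≠ x i)
    (hij : ∀ j, j ≠ i → ∃ y ∈ A, xor (y i) (x i) ≠ xor (y j) (x j)) : IsLonely A i := by
  refine ⟨?_, fun j hj => ?_⟩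
  · obtain ⟨y, hy, hne⟩ := hi
    refine hA.sum_eq_zero (fun a b c => bsign_xor3 a b c i) hy hx ?_
    revert hne
    cases y i <;> cases x i <;> simp [bsign]
  · obtain ⟨y, hy, hne⟩ := hij j hj
    refine hA.sum_eq_zero (φ := fun y => bsign (y i) * bsign (y j)) (fun a b c => ?_) hy hx ?_
    · simp only [bsign_xor3]
      ring
    · revert hne
      cases y i <;> cases x i <;> cases y j <;> cases x j <;> simp [bsign]

/-- An affine set of codimension at most `d` has at least `n - 2 * d` lonely coordinates. -/
theorem IsAffine.exists_isLonely {n d : ℕ} {A : Finset (Fin n → Bool)} (hA : IsAffine A)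
    {x : Fin n → Bool} (hx : x ∈ A) (hcard : 2 ^ n ≤ 2 ^ d * A.card) :
    ∃ F : Finset (Fin n), (∀ i ∈ F, IsLonely A i) ∧ n ≤ F.card + 2 * d := by
  classical
  let f : Fin n → A → Bool := fun i y => xor (y.1 i) (x i)
  let G : Finset (A → Bool) := (Finset.univ.image f).erase fun _ => false
  let F : Finset (Fin n) := Finset.univ.filter fun i => f i ∈ G ∧ ∀ j, f j = f i → j = i
  have hG : n ≤ G.card + d := by
    have hinj : Function.Injective fun (y : A) (g : G) => g.1 y := by
      intro y z hyz
      apply Subtype.ext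
      funext i
      have hf : f i y = f i z := by
        by_cases h : f i ∈ G
        · exact congrFun hyz ⟨f i, h⟩
        · have h0 : f i = fun _ => false := by
            by_contra h0
            exact h (Finset.mem_erase.2 ⟨h0, Finset.mem_image_of_mem _ (Finset.mem_univ _)⟩)
          rw [h0]
      exact Bool.xor_left_inj.1 hf
    have hle := Fintype.card_le_of_injective _ hinj
    simp only [Fintype.card_coe, Fintype.card_fun, Fintype.card_bool] at hle
    refine (Nat.pow_le_pow_iff_right (a := 2) one_lt_two).1 ?_
    rw [pow_add, mul_comm]
    exact hcard.trans (Nat.mul_le_mul_left _ hle)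
  have hfib : 2 * G.card ≤ n + F.card := by
    have h1 : ∑ g ∈ G, (Finset.univ.filter fun i => f i = g).card ≤ n := by
      rw [← Finset.card_biUnion]
      · simpa using Finset.card_le_univ (G.biUnion fun g => Finset.univ.filter fun i => f i = g)
      · intro g _ g' _ hne
        exact Finset.disjoint_filter.2 fun i _ h h' => hne (h.symm.trans h')
    have h2 : ∑ g ∈ G, (F.filter fun i => f i = g).card = F.card :=
      (Finset.card_eq_sum_card_fiberwise fun i hi => (Finset.mem_filter.1 hi).2.1).symm
    have h3 : ∑ _g ∈ G, 2 ≤ ∑ g ∈ G, ((Finset.univ.filter fun i => f i = g).card +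
        (F.filter fun i => f i = g).card) := by
      refine Finset.sum_le_sum fun g hg => ?_
      obtain ⟨i, -, rfl⟩ := Finset.mem_image.1 (Finset.mem_erase.1 hg).2
      have hi : i ∈ Finset.univ.filter fun j => f j = f i := by simp
      by_cases h : ∀ j, f j = f i → j = i
      · have hiF : i ∈ F.filter fun j => f j = f i :=
          Finset.mem_filter.2 ⟨Finset.mem_filter.2 ⟨Finset.mem_univ i, hg, h⟩, rfl⟩
        have := Finset.card_pos.2 ⟨i, hi⟩
        have := Finset.card_pos.2 ⟨i, hiF⟩
        omega
      · push Not at h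
        obtain ⟨j, hj, hji⟩ := h
        have := Finset.one_lt_card.2 ⟨j, by simpa using hj, i, hi, hji⟩
        omega
    rw [Finset.sum_add_distrib, h2, Finset.sum_const, smul_eq_mul] at h3
    omega
  refine ⟨F, fun i hi => ?_, by omega⟩
  obtain ⟨hiG, huniq⟩ := (Finset.mem_filter.1 hi).2
  refine hA.isLonely hx ?_ fun j hj => ?_
  · by_contra! h
    refine (Finset.mem_erase.1 hiG).1 (funext fun y => ?_)
    simp [f, h y.1 y.2]
  · by_contra! h
    exact hj (huniq j (funext fun y => (h y.1 y.2).symm))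

theorem isAffine_univ {n : ℕ} : IsAffine (Finset.univ : Finset (Fin n → Bool)) :=
  fun _ _ _ _ _ _ => Finset.mem_univ _

theorem sum_univ_sq_sum_bsign (n : ℕ) :
    ∑ y : Fin n → Bool, (∑ i, bsign (y i)) ^ 2 = 2 ^ n * n := by
  obtain ⟨F, hF, hcard⟩ := (isAffine_univ (n := n)).exists_isLonely (d := 0)
    (Finset.mem_univ fun _ => true) (by simp)
  obtain rfl : F = Finset.univ :=
    Finset.eq_univ_of_card F (le_antisymm (Finset.card_le_univ F) (by simpa using hcard))
  simpa using sum_sq_of_isLonely hF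

/-- Averaging over the blocks of a partition preserves the total. -/
theorem sum_fiber_average {α β : Type*} [Fintype α] [DecidableEq β] (p : α → β) (g : α → ℝ) :
    ∑ x, (∑ y with p y = p x, g y) / ((Finset.univ.filter fun y => p y = p x).card : ℝ) =
      ∑ y, g y := by
  simp only [Finset.sum_div, Finset.sum_filter]
  rw [Finset.sum_comm]
  refine Finset.sum_congr rfl fun y _ => ?_
  have hpos : ((Finset.univ.filter fun z => p z = p y).card : ℝ) ≠ 0 :=
    Nat.cast_ne_zero.2 (Finset.card_ne_zero_of_mem (a := y) (by simp))
  have h : ∀ x, (if p y = p x then g y else 0) /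
      ((Finset.univ.filter fun z => p z = p x).card : ℝ) =
      if p x = p y then g y / ((Finset.univ.filter fun z => p z = p y).card : ℝ) else 0 := by
    intro x
    by_cases hxy : p x = p y
    · simp [hxy]
    · simp [hxy, Ne.symm hxy]
  rw [Finset.sum_congr rfl fun x _ => h x, ← Finset.sum_filter, Finset.sum_const, nsmul_eq_mul]
  field_simp

theorem PDT.sq_sum_leafVec_le {n : ℕ} (T : PDT n) (x : Fin n → Bool) :
    (∑ i, T.leafVec x i) ^ 2 ≤
      (∑ y with T.leafId y = T.leafId x, (∑ i, bsign (y i)) ^ 2) /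
        ((Finset.univ.filter fun y => T.leafId y = T.leafId x).card : ℝ) -
      n + 2 * T.depthOn x := by
  obtain ⟨hA, hcard⟩ := isAffine_univ.filter_leafId T x (Finset.mem_univ x)
  have hx : x ∈ Finset.univ.filter fun y => T.leafId y = T.leafId x := by simp
  have hsum : ∑ i, T.leafVec x i = (∑ y with T.leafId y = T.leafId x, ∑ i, bsign (y i)) /
      ((Finset.univ.filter fun y => T.leafId y = T.leafId x).card : ℝ) := by
    simp only [PDT.leafVec, ← Finset.sum_div, ← Finset.sum_filter]
    rw [Finset.sum_comm]
  obtain ⟨F, hF, hFn⟩ := hA.exists_isLonely hx (by simpa using hcard)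
  have hvar := sq_sum_add_card_le_of_isLonely hF
  have hpos : (0 : ℝ) < (Finset.univ.filter fun y => T.leafId y = T.leafId x).card :=
    Nat.cast_pos.2 (Finset.card_pos.2 ⟨x, hx⟩)
  have hFn' : (n : ℝ) ≤ F.card + 2 * T.depthOn x := by exact_mod_cast hFn
  rw [hsum]
  generalize ((Finset.univ.filter fun y => T.leafId y = T.leafId x).card : ℝ) = a at *
  have hle : ((∑ y with T.leafId y = T.leafId x, ∑ i, bsign (y i)) / a) ^ 2 + F.card ≤
      (∑ y with T.leafId y = T.leafId x, (∑ i, bsign (y i)) ^ 2) / a := by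
    rw [div_pow, div_add' _ _ _ (by positivity), div_le_div_iff₀ (by positivity) hpos]
    nlinarith
  linarith

/-- **Remark.** For any parity decision tree `T`, `E_{ℓ∈T}[(∑ᵢ ℓᵢ)²]` is at most
twice the average depth of `T`, i.e. twice the expected number of internal nodes on
the root-to-leaf path followed by a uniform random input. -/
theorem pdt_leaf_second_moment_le_two_avg_depth {n : ℕ} (T : PDT n) :
    (∑ x : Fin n → Bool, (∑ i : Fin n, T.leafVec x i) ^ 2) / 2 ^ n ≤
      2 * ((∑ x : Fin n → Bool, (T.depthOn x : ℝ)) / 2 ^ n) := by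
  rw [← mul_div_assoc]
  refine div_le_div_of_nonneg_right ?_ (by positivity)
  refine (Finset.sum_le_sum fun x _ => T.sq_sum_leafVec_le x).trans (le_of_eq ?_)
  rw [Finset.sum_add_distrib, Finset.sum_sub_distrib, sum_fiber_average, sum_univ_sq_sum_bsign,
    Finset.mul_sum]
  simp
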